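/- Let n ≥ 2, let M be a matroid on [n], and let 0 < q ≤ 1. Then the function w ↦ log Z_M(q, w) is concave on the open positive orthant ℝ_{>0}^{n+1}; equivalently, for all u, v in ℝ_{>0}^{n+1} and all 0 ≤ t ≤ 1, Z_M(q, t·u + (1−t)·v) ≥ Z_M(q, u)^t · Z_M(q, v)^{1−t}. -/

import Mathlib

open MvPolynomial Finset

/-- Rank-function axioms for a matroid on `[n]` (Oxley, Theorem 1.3.2). -/
def IsMatroidRank (n : ℕ) (rk : Finset (Fin n) → ℕ) : Prop :=
  (∀ A, rk A ≤ A.card) ∧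
  (∀ A B, A ⊆ B → rk A ≤ rk B) ∧
  (∀ A B : Finset (Fin n), rk (A ∪ B) + rk (A ∩ B) ≤ rk A + rk B)

/-- `Z^k_M(q, w)`. -/
noncomputable def Zk (n : ℕ) (q : ℝ) (rk : Finset (Fin n) → ℕ) (k : ℕ) :
    MvPolynomial (Fin n) ℝ :=
  ∑ A ∈ Finset.powersetCard k (Finset.univ : Finset (Fin n)),
    C (q ^ (-(rk A : ℤ))) * ∏ i ∈ A, X i

/-- The homogeneous multivariate Tutte polynomial. -/
noncomputable def ZM (n : ℕ) (q : ℝ) (rk : Finset (Fin n) → ℕ) :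
    MvPolynomial (Fin (n+1)) ℝ :=
  ∑ k ∈ Finset.range (n+1), rename Fin.succ (Zk n q rk (n-k)) * X 0 ^ k


open Matrix in
/-- The reverse Cauchy-Schwarz inequality at `w` for the quadratic form of `H`. -/
def ReverseCauchySchwarz {σ : Type*} [Fintype σ] (H : Matrix σ σ ℝ) (w : σ → ℝ) : Prop :=
  ∀ x, (w ⬝ᵥ H *ᵥ w) * (x ⬝ᵥ H *ᵥ x) ≤ (w ⬝ᵥ H *ᵥ x) ^ 2

section LinearAlgebra

open Matrix

variable {σ : Type*} [Fintype σ]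

theorem dotProduct_mulVec_comm {H : Matrix σ σ ℝ} (hH : H.IsSymm) (x y : σ → ℝ) :
    x ⬝ᵥ H *ᵥ y = y ⬝ᵥ H *ᵥ x := by
  rw [dotProduct_mulVec, ← mulVec_transpose, hH.eq, dotProduct_comm]

theorem dotProduct_mulVec_nonpos_of_orthogonal [DecidableEq σ] {B : Matrix σ σ ℝ}
    (hB : B.IsSymm) (y : σ → ℝ)
    (hy : ∀ (e : σ → ℝ) (l : ℝ), e ⬝ᵥ e = 1 → B *ᵥ e = l • e → 0 < l → e ⬝ᵥ y = 0) :
    y ⬝ᵥ B *ᵥ y ≤ 0 := by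
  have hB' : B.IsHermitian := by
    rw [Matrix.IsHermitian, conjTranspose_eq_transpose_of_trivial, hB.eq]
  have key := hB'.eigenvectorBasis.sum_inner_mul_inner (WithLp.toLp 2 y) (WithLp.toLp 2 (B *ᵥ y))
  have e1 : inner ℝ (WithLp.toLp 2 y) (WithLp.toLp 2 (B *ᵥ y)) = y ⬝ᵥ B *ᵥ y := by
    simp [EuclideanSpace.inner_eq_star_dotProduct, dotProduct_comm]
  rw [← e1, ← key]
  refine Finset.sum_nonpos fun i _ => ?_
  set e : σ → ℝ := (hB'.eigenvectorBasis i).ofLp with he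
  have he1 : e ⬝ᵥ e = 1 := by
    have := hB'.eigenvectorBasis.orthonormal.1 i
    have h2 := real_inner_self_eq_norm_sq (hB'.eigenvectorBasis i)
    rw [this, EuclideanSpace.inner_eq_star_dotProduct] at h2
    simpa using h2
  have he2 : B *ᵥ e = hB'.eigenvalues i • e := hB'.mulVec_eigenvectorBasis i
  have a1 : inner ℝ (WithLp.toLp 2 y) (hB'.eigenvectorBasis i) = e ⬝ᵥ y := by
    simp [EuclideanSpace.inner_eq_star_dotProduct, he]
  have a2 : inner ℝ (hB'.eigenvectorBasis i) (WithLp.toLp 2 (B *ᵥ y)) =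
      hB'.eigenvalues i * (e ⬝ᵥ y) := by
    have : inner ℝ (hB'.eigenvectorBasis i) (WithLp.toLp 2 (B *ᵥ y)) = e ⬝ᵥ B *ᵥ y := by
      simp [EuclideanSpace.inner_eq_star_dotProduct, he, dotProduct_comm]
    rw [this, dotProduct_mulVec_comm hB, he2, dotProduct_smul, smul_eq_mul, dotProduct_comm]
  rw [a1, a2]
  by_cases hl : 0 < hB'.eigenvalues i
  · rw [hy e _ he1 he2 hl]; simp
  · nlinarith [sq_nonneg (e ⬝ᵥ y)]

theorem reverseCauchySchwarz_of_base {H : Matrix σ σ ℝ} (hH : H.IsSymm) {e : σ → ℝ}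
    (h : ReverseCauchySchwarz H e) (h0 : 0 < e ⬝ᵥ H *ᵥ e) {w : σ → ℝ}
    (hw : 0 ≤ w ⬝ᵥ H *ᵥ w) : ReverseCauchySchwarz H w := by
  intro x
  rcases hw.eq_or_lt with hw0 | hw0
  · rw [← hw0, zero_mul]; positivity
  have hew : e ⬝ᵥ H *ᵥ w ≠ 0 := by
    intro hc
    have := h w
    rw [hc] at this
    nlinarith [mul_pos h0 hw0]
  set s := (e ⬝ᵥ H *ᵥ x) / (e ⬝ᵥ H *ᵥ w) with hs
  have hy := h (x - s • w)
  have h1 : e ⬝ᵥ H *ᵥ (x - s • w) = 0 := by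
    rw [mulVec_sub, mulVec_smul, dotProduct_sub, dotProduct_smul, smul_eq_mul, hs]
    field_simp; ring
  have h2 : (x - s • w) ⬝ᵥ H *ᵥ (x - s • w) =
      x ⬝ᵥ H *ᵥ x - 2 * s * (w ⬝ᵥ H *ᵥ x) + s ^ 2 * (w ⬝ᵥ H *ᵥ w) := by
    simp only [mulVec_sub, mulVec_smul, dotProduct_sub, dotProduct_smul, sub_dotProduct,
      smul_dotProduct, smul_eq_mul, dotProduct_mulVec_comm hH x w]
    ring
  rw [h1] at hy
  have h3 : (x - s • w) ⬝ᵥ H *ᵥ (x - s • w) ≤ 0 := by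
    by_contra hc
    push Not at hc
    nlinarith [mul_pos h0 hc]
  rw [h2] at h3
  nlinarith [sq_nonneg (s * (w ⬝ᵥ H *ᵥ w) - w ⬝ᵥ H *ᵥ x), mul_nonneg hw0.le (sub_nonneg.2 h3)]

/-- Shenfeld and van Handel's Bochner-type criterion, for a matrix with a dominating vertex. -/
theorem reverseCauchySchwarz_of_bochner [DecidableEq σ] {H : Matrix σ σ ℝ} (hH : H.IsSymm)
    (hnn : ∀ i j, 0 ≤ H i j) {w : σ → ℝ} (hw : ∀ i, 0 < w i) (o : σ)
    (ho : ∀ i, (∀ j, H i j = 0) ∨ 0 < H o i)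
    (hbochner : ∀ x, x ⬝ᵥ H *ᵥ x ≤ ∑ i, w i * (H *ᵥ x) i ^ 2 / (H *ᵥ w) i) :
    ReverseCauchySchwarz H w := by
  have hHw : ∀ i, 0 ≤ (H *ᵥ w) i := fun i =>
    Finset.sum_nonneg fun j _ => mul_nonneg (hnn i j) (hw j).le
  have hww : 0 ≤ w ⬝ᵥ H *ᵥ w := Finset.sum_nonneg fun i _ => mul_nonneg (hw i).le (hHw i)
  have hact : ∀ i, (∀ j, H i j = 0) ∨ (0 < H o i ∧ 0 < (H *ᵥ w) i) := by
    intro i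
    refine (ho i).imp_right fun h => ⟨h, ?_⟩
    refine Finset.sum_pos' (fun j _ => mul_nonneg (hnn i j) (hw j).le) ⟨o, mem_univ _, ?_⟩
    change 0 < H i o * w o
    rw [← hH.apply i o]
    exact mul_pos h (hw o)
  -- it suffices to treat vectors orthogonal to `w`
  suffices hmain : ∀ x, w ⬝ᵥ H *ᵥ x = 0 → x ⬝ᵥ H *ᵥ x ≤ 0 by
    intro x
    rcases hww.eq_or_lt with hw0 | hw0
    · rw [← hw0, zero_mul]; positivity
    set c := (w ⬝ᵥ H *ᵥ x) / (w ⬝ᵥ H *ᵥ w) with hc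
    have h1 := hmain (x - c • w) (by
      rw [mulVec_sub, mulVec_smul, dotProduct_sub, dotProduct_smul, smul_eq_mul, hc]
      field_simp; ring)
    have h2 : (x - c • w) ⬝ᵥ H *ᵥ (x - c • w) =
        x ⬝ᵥ H *ᵥ x - 2 * c * (w ⬝ᵥ H *ᵥ x) + c ^ 2 * (w ⬝ᵥ H *ᵥ w) := by
      simp only [mulVec_sub, mulVec_smul, dotProduct_sub, dotProduct_smul, sub_dotProduct,
        smul_dotProduct, smul_eq_mul, dotProduct_mulVec_comm hH x w]
      ring
    rw [h2] at h1
    nlinarith [sq_nonneg (c * (w ⬝ᵥ H *ᵥ w) - w ⬝ᵥ H *ᵥ x), mul_nonneg hw0.le (sub_nonneg.2 h1)]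
  intro x hx
  set s : σ → ℝ := fun i => √(w i / (H *ᵥ w) i) with hs
  have hs2 : ∀ i, s i ^ 2 = w i / (H *ᵥ w) i := fun i =>
    Real.sq_sqrt (div_nonneg (hw i).le (hHw i))
  set B : Matrix σ σ ℝ := Matrix.of fun i j => s i * H i j * s j with hBdef
  have hBsymm : B.IsSymm := by
    ext i j
    simp only [hBdef, transpose_apply, of_apply, hH.apply i j]
    ring
  have hBmul : ∀ y i, (B *ᵥ y) i = s i * (H *ᵥ (s * y)) i := by
    intro y i
    simp only [hBdef, mulVec, dotProduct, of_apply, Finset.mul_sum, Pi.mul_apply]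
    exact Finset.sum_congr rfl fun j _ => by ring
  have hBquad : ∀ y, y ⬝ᵥ B *ᵥ y = (s * y) ⬝ᵥ H *ᵥ (s * y) := by
    intro y
    simp only [dotProduct, hBmul, Pi.mul_apply]
    exact Finset.sum_congr rfl fun j _ => by ring
  have hBsq : ∀ y, y ⬝ᵥ B *ᵥ y ≤ (B *ᵥ y) ⬝ᵥ (B *ᵥ y) := by
    intro y
    rw [hBquad]
    refine (hbochner _).trans_eq (Finset.sum_congr rfl fun i _ => ?_)
    rw [hBmul, mul_mul_mul_comm, ← sq, ← sq, hs2]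
    ring
  set y : σ → ℝ := fun i => x i / s i with hy
  have hsy : H *ᵥ (s * y) = H *ᵥ x := by
    ext i
    refine Finset.sum_congr rfl fun j _ => ?_
    change H i j * (s * y) j = H i j * x j
    rcases hact j with h | h
    · rw [← hH.apply i j, h]; simp
    · have : s j ≠ 0 := (Real.sqrt_pos.2 (div_pos (hw j) h.2)).ne'
      simp only [Pi.mul_apply, hy]
      field_simp
  have hxy : y ⬝ᵥ B *ᵥ y = x ⬝ᵥ H *ᵥ x := by
    rw [hBquad, hsy, dotProduct_mulVec_comm hH, hsy]
  rw [← hxy]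
  refine dotProduct_mulVec_nonpos_of_orthogonal hBsymm y fun e l he1 hel hl => ?_
  have hl1 : 1 ≤ l := by
    have := hBsq e
    rw [hel, dotProduct_smul, smul_dotProduct, dotProduct_smul, he1] at this
    simp only [smul_eq_mul, mul_one] at this
    by_contra hc
    push Not at hc
    nlinarith
  set z := s * e with hz
  have hzz : 1 ≤ z ⬝ᵥ H *ᵥ z := by
    rw [hz, ← hBquad, hel, dotProduct_smul, he1]
    simpa using hl1
  have hexp : ∑ i, ∑ j, H i j * w i * w j * (z i / w i - z j / w j) ^ 2 =
      2 * (∑ i, z i ^ 2 / w i * (H *ᵥ w) i) - 2 * (z ⬝ᵥ H *ᵥ z) := by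
    have t1 : ∀ i j, H i j * w i * w j * (z i / w i - z j / w j) ^ 2 =
        z i ^ 2 / w i * (H i j * w j) + z j ^ 2 / w j * (H j i * w i)
          - 2 * (z i * (H i j * z j)) := by
      intro i j
      have h1 := (hw i).ne'
      have h2 := (hw j).ne'
      rw [← hH.apply i j]
      field_simp
      ring
    simp only [t1, Finset.sum_add_distrib, Finset.sum_sub_distrib, ← Finset.mul_sum]
    rw [Finset.sum_comm (f := fun i j => z j ^ 2 / w j * (H j i * w i))]
    simp only [← Finset.mul_sum, mulVec, dotProduct]
    ring
  have hzs : ∑ i, z i ^ 2 / w i * (H *ᵥ w) i ≤ 1 := by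
    rw [← he1]
    refine Finset.sum_le_sum fun i _ => ?_
    have : z i ^ 2 = w i / (H *ᵥ w) i * e i ^ 2 := by
      rw [hz, Pi.mul_apply, mul_pow, hs2]
    rw [this]
    rcases (hHw i).eq_or_lt with h | h
    · rw [← h, mul_zero]; exact mul_self_nonneg _
    · have h1 := (hw i).ne'
      have h2 := h.ne'
      refine le_of_eq ?_
      field_simp
  have hterm : ∀ i j, 0 ≤ H i j * w i * w j * (z i / w i - z j / w j) ^ 2 := fun i j =>
    mul_nonneg (mul_nonneg (mul_nonneg (hnn i j) (hw i).le) (hw j).le) (sq_nonneg _)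
  have hzero : ∑ i, ∑ j, H i j * w i * w j * (z i / w i - z j / w j) ^ 2 = 0 :=
    le_antisymm (by linarith) (Finset.sum_nonneg fun i _ => Finset.sum_nonneg fun j _ => hterm i j)
  have hprop : ∀ i, 0 < H o i → z i = z o / w o * w i := by
    intro i hi
    have h1 := (Finset.sum_eq_zero_iff_of_nonneg
      (fun i _ => Finset.sum_nonneg fun j _ => hterm i j)).1 hzero o (mem_univ _)
    have h2 := (Finset.sum_eq_zero_iff_of_nonneg (fun j _ => hterm o j)).1 h1 i (mem_univ _)
    have h3 : H o i * w o * w i ≠ 0 := (mul_pos (mul_pos hi (hw o)) (hw i)).ne'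
    have h4 := pow_eq_zero_iff (two_ne_zero) |>.1 ((mul_eq_zero.1 h2).resolve_left h3)
    have h5 := (hw i).ne'
    rw [sub_eq_zero.1 h4]
    field_simp
  calc e ⬝ᵥ y = ∑ i, z o / w o * ((H *ᵥ w) i * x i) := by
        refine Finset.sum_congr rfl fun i _ => ?_
        rcases hact i with h | h
        · have h0 : (H *ᵥ w) i = 0 := Finset.sum_eq_zero fun j _ =>
            mul_eq_zero_of_left (h j) _
          simp [hy, hs, h0]
        · have h6 : s i ≠ 0 := (Real.sqrt_pos.2 (div_pos (hw i) h.2)).ne'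
          have h7 : e i = z i / s i := by
            rw [hz, Pi.mul_apply]; field_simp
          have h8 : e i * y i = z i * x i / s i ^ 2 := by
            rw [h7]; simp only [hy]; field_simp
          rw [h8, hs2, hprop i h.1]
          have h9 := (hw i).ne'
          have h10 := h.2.ne'
          field_simp
    _ = z o / w o * (w ⬝ᵥ H *ᵥ x) := by
        rw [← Finset.mul_sum, dotProduct_mulVec_comm hH, dotProduct_comm]
        rfl
    _ = 0 := by rw [hx, mul_zero]

end LinearAlgebra

section Polynomial

open Matrix

variable {σ : Type*}

theorem MvPolynomial.pderiv_pderiv_comm (i j : σ) (f : MvPolynomial σ ℝ) :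
    pderiv i (pderiv j f) = pderiv j (pderiv i f) := by
  ext m
  simp only [coeff_pderiv]
  rw [add_right_comm]
  rcases eq_or_ne i j with rfl | h
  · rfl
  · simp only [Finsupp.add_apply, Finsupp.single_eq_of_ne h, Finsupp.single_eq_of_ne h.symm,
      add_zero, mul_right_comm]

/-- The Hessian matrix of a polynomial at a point. -/
noncomputable def hessian (f : MvPolynomial σ ℝ) (w : σ → ℝ) : Matrix σ σ ℝ :=
  Matrix.of fun i j => eval w (pderiv i (pderiv j f))

theorem hessian_apply (f : MvPolynomial σ ℝ) (w : σ → ℝ) (i j : σ) :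
    hessian f w i j = eval w (pderiv i (pderiv j f)) := rfl

theorem hessian_isSymm (f : MvPolynomial σ ℝ) (w : σ → ℝ) : (hessian f w).IsSymm := by
  ext i j
  rw [transpose_apply, hessian_apply, hessian_apply, pderiv_pderiv_comm]

variable [Fintype σ]

theorem MvPolynomial.IsHomogeneous.sum_mul_eval_pderiv {f : MvPolynomial σ ℝ} {d : ℕ}
    (hf : f.IsHomogeneous d) (w : σ → ℝ) :
    ∑ i, w i * eval w (pderiv i f) = d * eval w f := by
  simpa using congrArg (eval w) hf.sum_X_mul_pderiv

theorem hessian_mulVec_self {f : MvPolynomial σ ℝ} {d : ℕ} (hf : f.IsHomogeneous (d + 1))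
    (w : σ → ℝ) (i : σ) : (hessian f w *ᵥ w) i = d * eval w (pderiv i f) := by
  have h := (hf.pderiv (i := i)).sum_mul_eval_pderiv w
  rw [Nat.add_sub_cancel] at h
  rw [← h]
  refine Finset.sum_congr rfl fun j _ => ?_
  change hessian f w i j * w j = _
  rw [hessian_apply, pderiv_pderiv_comm, mul_comm]

theorem sum_mul_hessian_pderiv {f : MvPolynomial σ ℝ} {d : ℕ} (hf : f.IsHomogeneous (d + 2))
    (w x : σ → ℝ) :
    ∑ k, w k * (x ⬝ᵥ hessian (pderiv k f) w *ᵥ x) = d * (x ⬝ᵥ hessian f w *ᵥ x) := by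
  have hent : ∀ i j, ∑ k, w k * hessian (pderiv k f) w i j = d * hessian f w i j := by
    intro i j
    have h := ((hf.pderiv (i := j)).pderiv (i := i)).sum_mul_eval_pderiv w
    simp only [show d + 2 - 1 - 1 = d by omega] at h
    rw [hessian_apply, ← h]
    refine Finset.sum_congr rfl fun k _ => ?_
    rw [hessian_apply, pderiv_pderiv_comm j k, pderiv_pderiv_comm i k]
  simp only [dotProduct, mulVec, Finset.mul_sum]
  rw [Finset.sum_comm]
  refine Finset.sum_congr rfl fun i _ => ?_
  rw [Finset.sum_comm]
  refine Finset.sum_congr rfl fun j _ => ?_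
  rw [show (d : ℝ) * (x i * (hessian f w i j * x j)) = x i * x j * (d * hessian f w i j) by ring,
    ← hent, Finset.mul_sum]
  exact Finset.sum_congr rfl fun k _ => by ring

/-- If the first partial derivatives of `f` have Lorentzian Hessians at `w`, so does `f`. -/
theorem reverseCauchySchwarz_hessian_of_pderiv [DecidableEq σ] {f : MvPolynomial σ ℝ} {d : ℕ}
    (hf : f.IsHomogeneous (d + 3)) {w : σ → ℝ} (hw : ∀ i, 0 < w i)
    (hnn : ∀ i j, 0 ≤ hessian f w i j) (o : σ)
    (ho : ∀ i, pderiv i f = 0 ∨ 0 < hessian f w o i)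
    (hder : ∀ i, ReverseCauchySchwarz (hessian (pderiv i f) w) w) :
    ReverseCauchySchwarz (hessian f w) w := by
  have hsymm := hessian_isSymm f w
  have hrow : ∀ i, pderiv i f = 0 → ∀ j, hessian f w i j = 0 := by
    intro i hi j
    rw [hessian_apply, pderiv_pderiv_comm, hi, map_zero, map_zero]
  refine reverseCauchySchwarz_of_bochner hsymm hnn hw o
    (fun i => (ho i).imp_left (hrow i)) fun x => ?_
  have hd : (0 : ℝ) < (d + 1 : ℕ) := by positivity
  refine le_of_mul_le_mul_left ?_ hd
  rw [← sum_mul_hessian_pderiv hf w x, Finset.mul_sum]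
  refine Finset.sum_le_sum fun k _ => ?_
  rcases ho k with hk | hk
  · have h1 : (hessian f w *ᵥ x) k = 0 := Finset.sum_eq_zero fun j _ =>
      mul_eq_zero_of_left (hrow k hk j) _
    have h2 : hessian (pderiv k f) w = 0 := by
      ext i j
      simp [hessian_apply, hk]
    simp [h1, h2]
  have hpos : 0 < (hessian f w *ᵥ w) k := by
    refine Finset.sum_pos' (fun j _ => mul_nonneg (hnn k j) (hw j).le) ⟨o, mem_univ _, ?_⟩
    change 0 < hessian f w k o * w o
    rw [← hsymm.apply k o]
    exact mul_pos hk (hw o)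
  have hgrad : hessian (pderiv k f) w *ᵥ w = ((d + 1 : ℕ) : ℝ) • fun i => hessian f w k i := by
    ext i
    have hk' : (pderiv k f).IsHomogeneous (d + 1 + 1) := hf.pderiv
    rw [hessian_mulVec_self hk', Pi.smul_apply, ← hsymm.apply k i]
    rfl
  have hwx : ∀ x, w ⬝ᵥ hessian (pderiv k f) w *ᵥ x = (d + 1 : ℕ) * (hessian f w *ᵥ x) k := by
    intro x
    rw [dotProduct_mulVec_comm (hessian_isSymm _ w), hgrad, dotProduct_smul, dotProduct_comm]
    rfl
  have h := hder k x
  rw [hwx, hwx] at h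
  have h3 : x ⬝ᵥ hessian (pderiv k f) w *ᵥ x ≤
      (d + 1 : ℕ) * ((hessian f w *ᵥ x) k ^ 2 / (hessian f w *ᵥ w) k) := by
    rw [← mul_div_assoc, le_div_iff₀ hpos]
    nlinarith
  calc _ ≤ _ := mul_le_mul_of_nonneg_left h3 (hw k).le
    _ = _ := by ring

theorem MvPolynomial.hasDerivAt_eval_line (f : MvPolynomial σ ℝ) (v x : σ → ℝ) (t : ℝ) :
    HasDerivAt (fun t : ℝ => eval (fun i => v i + t * x i) f)
      (∑ i, x i * eval (fun i => v i + t * x i) (pderiv i f)) t := by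
  classical
  induction f using MvPolynomial.induction_on with
  | C a => simpa using hasDerivAt_const t a
  | add p q hp hq =>
    simp only [map_add, mul_add, Finset.sum_add_distrib]
    exact hp.add hq
  | mul_X p j hp =>
    have hX : HasDerivAt (fun t : ℝ => v j + t * x j) (x j) t := by
      simpa using ((hasDerivAt_id t).mul_const (x j)).const_add (v j)
    simp only [map_mul, eval_X, pderiv_mul, map_add, mul_add (x _), Finset.sum_add_distrib]
    refine (hp.fun_mul hX).congr_deriv ?_
    rw [Finset.sum_mul]
    refine congrArg₂ (· + ·) (Finset.sum_congr rfl fun i _ => by ring) ?_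
    rw [Finset.sum_eq_single j]
    · rw [pderiv_X_self, map_one]; ring
    · intro i _ hi
      rw [pderiv_X_of_ne hi.symm]; simp
    · simp

/-- A Lorentzian Hessian makes the second derivative of the logarithm nonpositive. -/
theorem eval_mul_hessian_le_sq_gradient {f : MvPolynomial σ ℝ} {d : ℕ}
    (hf : f.IsHomogeneous (d + 2)) {w : σ → ℝ} (h : ReverseCauchySchwarz (hessian f w) w)
    (x : σ → ℝ) :
    eval w f * (x ⬝ᵥ hessian f w *ᵥ x) ≤ (∑ i, x i * eval w (pderiv i f)) ^ 2 := by
  have hwx : ∀ x, w ⬝ᵥ hessian f w *ᵥ x = (d + 1 : ℕ) * ∑ i, x i * eval w (pderiv i f) := by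
    intro x
    rw [dotProduct_mulVec_comm (hessian_isSymm _ w), Finset.mul_sum]
    refine Finset.sum_congr rfl fun i _ => ?_
    rw [hessian_mulVec_self (d := d + 1) hf]
    ring
  have hx := h x
  rw [hwx, hwx, hf.sum_mul_eval_pderiv] at hx
  push_cast at hx
  have hd : (0 : ℝ) ≤ d := by positivity
  set F := eval w f
  set G := ∑ i, x i * eval w (pderiv i f)
  set Q := x ⬝ᵥ hessian f w *ᵥ x
  have h1 : (d + 2) * (F * Q) ≤ (d + 1) * G ^ 2 := by
    refine le_of_mul_le_mul_left ?_ (show (0 : ℝ) < d + 1 by positivity)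
    linarith
  refine le_of_mul_le_mul_left ?_ (show (0 : ℝ) < d + 2 by positivity)
  nlinarith [sq_nonneg G]

theorem concaveOn_log_eval_of_hessian {f : MvPolynomial σ ℝ} {d : ℕ}
    (hf : f.IsHomogeneous (d + 2)) (hpos : ∀ w : σ → ℝ, (∀ i, 0 < w i) → 0 < eval w f)
    (h : ∀ w : σ → ℝ, (∀ i, 0 < w i) → ReverseCauchySchwarz (hessian f w) w) :
    ConcaveOn ℝ {w : σ → ℝ | ∀ i, 0 < w i} (fun w => Real.log (eval w f)) := by
  have hconv : Convex ℝ {w : σ → ℝ | ∀ i, 0 < w i} := by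
    intro u hu v hv a b ha hb hab i
    exact (convex_Ioi (0 : ℝ)) (hu i) (hv i) ha hb hab
  refine ⟨hconv, fun u hu v hv a b ha hb hab => ?_⟩
  set x : σ → ℝ := fun i => u i - v i with hx
  set p : ℝ → σ → ℝ := fun t i => v i + t * x i with hp
  have hpline : ∀ t, p t = t • u + (1 - t) • v := by
    intro t; ext i; simp only [hp, hx, Pi.add_apply, Pi.smul_apply, smul_eq_mul]; ring
  have hpmem : ∀ t ∈ Set.Icc (0 : ℝ) 1, ∀ i, 0 < p t i := by
    intro t ht
    rw [hpline]
    exact hconv hu hv ht.1 (by linarith [ht.2]) (by ring)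
  have hF := fun t => hasDerivAt_eval_line f v x t
  have hG : ∀ t, HasDerivAt (fun t : ℝ => ∑ i, x i * eval (p t) (pderiv i f))
      (x ⬝ᵥ hessian f (p t) *ᵥ x) t := by
    intro t
    refine (HasDerivAt.fun_sum fun i _ =>
      (hasDerivAt_eval_line (pderiv i f) v x t).const_mul (x i)).congr_deriv ?_
    refine Finset.sum_congr rfl fun i _ => congrArg (x i * ·) (Finset.sum_congr rfl fun j _ => ?_)
    change _ = hessian f (p t) i j * x j
    rw [hessian_apply, pderiv_pderiv_comm, mul_comm]
  have hint : ∀ t ∈ interior (Set.Icc (0 : ℝ) 1), 0 < eval (p t) f := fun t ht =>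
    hpos _ (hpmem t (interior_subset ht))
  have hconc : ConcaveOn ℝ (Set.Icc (0 : ℝ) 1) (fun t => Real.log (eval (p t) f)) := by
    refine concaveOn_of_hasDerivWithinAt2_nonpos (convex_Icc 0 1)
      (fun t ht => ((hF t).log (hpos _ (hpmem t ht)).ne').continuousAt.continuousWithinAt)
      (fun t ht => ((hF t).log (hint t ht).ne').hasDerivWithinAt)
      (fun t ht => ((hG t).div (hF t) (hint t ht).ne').hasDerivWithinAt) fun t ht => ?_
    refine div_nonpos_of_nonpos_of_nonneg ?_ (sq_nonneg _)
    have := eval_mul_hessian_le_sq_gradient hf (h _ (hpmem t (interior_subset ht))) x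
    change (x ⬝ᵥ hessian f (p t) *ᵥ x) * eval (p t) f -
      (∑ i, x i * eval (p t) (pderiv i f)) * (∑ i, x i * eval (p t) (pderiv i f)) ≤ 0
    linarith
  have := hconc.2 (Set.right_mem_Icc.2 zero_le_one) (Set.left_mem_Icc.2 zero_le_one) ha hb hab
  have e : b = 1 - a := by linarith
  simp only [hpline, e] at this ⊢
  simpa using this

end Polynomial

section PartitionInequality

variable {ι κ : Type*} [DecidableEq κ]

theorem sq_sum_le_card_mul_sum_fiber (T : Finset ι) (φ : ι → κ) (y : ι → ℝ) :
    (∑ i ∈ T, y i) ^ 2 ≤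
      #T * ∑ i ∈ T, ∑ j ∈ T, if φ i = φ j then y i * y j else 0 := by
  have hfib : ∑ i ∈ T, ∑ j ∈ T, (if φ i = φ j then y i * y j else 0) =
      ∑ k ∈ T.image φ, (∑ i ∈ T with φ i = k, y i) ^ 2 := by
    rw [← Finset.sum_fiberwise_of_maps_to (fun i hi => Finset.mem_image_of_mem φ hi)]
    refine Finset.sum_congr rfl fun k _ => ?_
    rw [sq, Finset.sum_mul]
    refine Finset.sum_congr rfl fun i hi => ?_
    rw [Finset.mul_sum, Finset.sum_filter]
    refine Finset.sum_congr rfl fun j _ => ?_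
    simp only [(Finset.mem_filter.1 hi).2, eq_comm]
  rw [hfib, ← Finset.sum_fiberwise_of_maps_to (fun i hi => Finset.mem_image_of_mem φ hi)]
  refine sq_sum_le_card_mul_sum_sq.trans ?_
  refine mul_le_mul_of_nonneg_right ?_ (Finset.sum_nonneg fun k _ => sq_nonneg _)
  exact_mod_cast Finset.card_image_le

theorem card_mul_sum_offDiag_le [DecidableEq ι] (T : Finset ι) (φ : ι → κ) (y : ι → ℝ) {q : ℝ}
    (hq0 : 0 ≤ q) (hq1 : q ≤ 1) :
    #T * ∑ i ∈ T, ∑ j ∈ T, (if i = j then 0 else (if φ i = φ j then q else 1) * (y i * y j)) ≤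
      (#T - 1) * (∑ i ∈ T, y i) ^ 2 := by
  have hsplit : ∀ i j, (if i = j then 0 else (if φ i = φ j then q else 1) * (y i * y j)) =
      y i * y j - (1 - q) * (if φ i = φ j then y i * y j else 0) -
        q * (if i = j then y i * y j else 0) := by
    intro i j
    by_cases h : i = j
    · subst h; simp only [if_true]; ring
    · by_cases h' : φ i = φ j
      · simp only [h, h', if_true, if_false]; ring
      · simp only [h, h', if_false]; ring
  simp only [hsplit, Finset.sum_sub_distrib, ← Finset.mul_sum]
  rw [← Finset.sum_mul]
  have h1 := sq_sum_le_card_mul_sum_fiber T φ y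
  have h2 := sq_sum_le_card_mul_sum_fiber T id y
  simp only [id] at h2
  nlinarith [mul_le_mul_of_nonneg_left h1 (sub_nonneg.2 hq1), mul_le_mul_of_nonneg_left h2 hq0]

end PartitionInequality

section MatroidRank

variable {n : ℕ} {rk : Finset (Fin n) → ℕ}

theorem IsMatroidRank.insert_le (hrk : IsMatroidRank n rk) (S : Finset (Fin n)) (i : Fin n) :
    rk (insert i S) ≤ rk S + 1 := by
  have h1 := hrk.2.2 {i} S
  have h2 := hrk.1 {i}
  rw [Finset.card_singleton] at h2
  rw [← Finset.insert_eq] at h1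
  omega

theorem IsMatroidRank.insert_insert_le (hrk : IsMatroidRank n rk) (S : Finset (Fin n))
    (i j : Fin n) : rk (insert i (insert j S)) + rk S ≤ rk (insert i S) + rk (insert j S) := by
  have h1 := hrk.2.2 (insert i S) (insert j S)
  have h2 := hrk.2.1 S (insert i S ∩ insert j S)
    (Finset.subset_inter (Finset.subset_insert _ _) (Finset.subset_insert _ _))
  have h3 : insert i S ∪ insert j S = insert i (insert j S) := by
    ext; simp only [Finset.mem_union, Finset.mem_insert]; tauto
  rw [h3] at h1
  omega

/-- Being equal or parallel in the contraction of a matroid by `S`. -/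
def parallelSetoid (hrk : IsMatroidRank n rk) (S : Finset (Fin n)) : Setoid (Fin n) where
  r i j := i = j ∨ (rk (insert i S) = rk S + 1 ∧ rk (insert j S) = rk S + 1 ∧
    rk (insert i (insert j S)) = rk S + 1)
  iseqv := by
    refine ⟨fun i => Or.inl rfl, ?_, ?_⟩
    · rintro i j (h | ⟨h1, h2, h3⟩)
      · exact Or.inl h.symm
      · exact Or.inr ⟨h2, h1, by rwa [Finset.insert_comm]⟩
    · rintro i j k (rfl | ⟨h1, h2, h3⟩) (rfl | ⟨h4, h5, h6⟩)
      · exact Or.inl rfl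
      · exact Or.inr ⟨h4, h5, h6⟩
      · exact Or.inr ⟨h1, h2, h3⟩
      · refine Or.inr ⟨h1, h5, ?_⟩
        have a1 := hrk.insert_insert_le (insert j S) i k
        have a2 := hrk.2.1 (insert i (insert k S)) (insert i (insert k (insert j S)))
          (Finset.insert_subset_insert _ (Finset.insert_subset_insert _ (Finset.subset_insert _ _)))
        have a3 := hrk.2.1 (insert k S) (insert i (insert k S)) (Finset.subset_insert _ _)
        rw [Finset.insert_comm k j S] at a1 a2
        omega

open Classical in
theorem zpow_rank_insert_insert (hrk : IsMatroidRank n rk) {q : ℝ} (hq : 0 < q)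
    (S : Finset (Fin n)) {i j : Fin n} (hij : i ≠ j) :
    q ^ (-(rk (insert i (insert j S)) : ℤ)) = q ^ (-(rk S : ℤ)) *
      ((if (Quotient.mk (parallelSetoid hrk S) i) = Quotient.mk (parallelSetoid hrk S) j
        then q else 1) *
      (q ^ ((rk S : ℤ) - rk (insert i S)) * q ^ ((rk S : ℤ) - rk (insert j S)))) := by
  have h1 := hrk.insert_insert_le S i j
  have h2 := hrk.insert_le S i
  have h3 := hrk.insert_le S j
  have h4 := hrk.2.1 (insert j S) (insert i (insert j S)) (Finset.subset_insert _ _)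
  have h5 := hrk.2.1 (insert i S) (insert i (insert j S))
    (Finset.insert_subset_insert _ (Finset.subset_insert _ _))
  have h6 := hrk.2.1 S (insert i S) (Finset.subset_insert _ _)
  have h7 := hrk.2.1 S (insert j S) (Finset.subset_insert _ _)
  have hq' := hq.ne'
  split_ifs with h
  · obtain h | ⟨h8, h9, h10⟩ := Quotient.exact h
    · exact absurd h hij
    · rw [← zpow_add₀ hq', ← zpow_one_add₀ hq', ← zpow_add₀ hq']
      congr 1
      omega
  · have h8 : ¬ (rk (insert i S) = rk S + 1 ∧ rk (insert j S) = rk S + 1 ∧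
        rk (insert i (insert j S)) = rk S + 1) := fun hc => h (Quotient.sound (Or.inr hc))
    rw [one_mul, ← zpow_add₀ hq', ← zpow_add₀ hq']
    congr 1
    omega

end MatroidRank

section TutteDerivatives

variable (n : ℕ) (q : ℝ) (rk : Finset (Fin n) → ℕ)

/-- The derivative of `ZM n q rk`, `a` times in the variable `0` and once in each element of `S`. -/
noncomputable def tutteDeriv (a : ℕ) (S : Finset (Fin n)) : MvPolynomial (Fin (n + 1)) ℝ :=
  ∑ B with S ⊆ B, C (q ^ (-(rk B : ℤ)) * (n - #B).descFactorial a) *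
    ((∏ i ∈ B \ S, X i.succ) * X 0 ^ (n - #B - a))

theorem ZM_eq_tutteDeriv : ZM n q rk = tutteDeriv n q rk 0 ∅ := by
  have h : tutteDeriv n q rk 0 ∅ = ∑ B ∈ (univ : Finset (Fin n)).powerset,
      C (q ^ (-(rk B : ℤ))) * ((∏ i ∈ B, X i.succ) * X 0 ^ (n - #B)) := by
    simp [tutteDeriv]
  rw [h, Finset.sum_powerset, ZM, ← Finset.sum_range_reflect]
  rw [Finset.card_univ, Fintype.card_fin]
  refine Finset.sum_congr rfl fun k hk => ?_
  have hk' : k ≤ n := Nat.lt_succ_iff.1 (Finset.mem_range.1 hk)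
  rw [show n + 1 - 1 - k = n - k by omega, show n - (n - k) = k by omega, Zk, map_sum,
    Finset.sum_mul]
  refine Finset.sum_congr rfl fun B hB => ?_
  rw [(Finset.mem_powersetCard.1 hB).2]
  simp [map_prod, mul_assoc]

variable {n}

theorem pderiv_prod_X_succ_of_notMem {j : Fin (n + 1)} {A : Finset (Fin n)}
    (h : ∀ i ∈ A, i.succ ≠ j) :
    pderiv j (∏ i ∈ A, X i.succ : MvPolynomial (Fin (n + 1)) ℝ) = 0 := by
  induction A using Finset.induction_on with
  | empty => simp
  | insert i A hi ih =>
    rw [Finset.prod_insert hi, pderiv_mul, ih fun k hk => h k (Finset.mem_insert_of_mem hk),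
      pderiv_X_of_ne (h i (Finset.mem_insert_self _ _))]
    simp

theorem pderiv_zero_tutteDeriv (a : ℕ) (S : Finset (Fin n)) :
    pderiv 0 (tutteDeriv n q rk a S) = tutteDeriv n q rk (a + 1) S := by
  rw [tutteDeriv, tutteDeriv, map_sum]
  refine Finset.sum_congr rfl fun B _ => ?_
  rw [pderiv_C_mul, pderiv_mul, pderiv_prod_X_succ_of_notMem fun i _ => Fin.succ_ne_zero i,
    pderiv_pow, pderiv_X_self, Nat.descFactorial_succ, ← Nat.sub_sub, ← map_natCast C]
  push_cast
  simp only [map_mul]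
  ring

theorem pderiv_succ_tutteDeriv (a : ℕ) (S : Finset (Fin n)) (i : Fin n) :
    pderiv i.succ (tutteDeriv n q rk a S) =
      if i ∈ S then 0 else tutteDeriv n q rk a (insert i S) := by
  have hX0 : ∀ k : ℕ, pderiv i.succ ((X 0 : MvPolynomial (Fin (n + 1)) ℝ) ^ k) = 0 := by
    intro k
    rw [pderiv_pow, pderiv_X_of_ne (Fin.succ_ne_zero i).symm, mul_zero]
  have hnot : ∀ B : Finset (Fin n), i ∉ B \ S →
      pderiv i.succ (∏ i ∈ B \ S, X i.succ : MvPolynomial (Fin (n + 1)) ℝ) = 0 := fun B hB =>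
    pderiv_prod_X_succ_of_notMem fun k hk hki => hB (Fin.succ_injective _ hki ▸ hk)
  rw [tutteDeriv, map_sum]
  split_ifs with hi
  · refine Finset.sum_eq_zero fun B _ => ?_
    rw [pderiv_C_mul, pderiv_mul, hX0, hnot B fun h => (Finset.mem_sdiff.1 h).2 hi]
    simp
  · rw [tutteDeriv, Finset.sum_filter, Finset.sum_filter]
    refine Finset.sum_congr rfl fun B _ => ?_
    simp only [Finset.insert_subset_iff]
    by_cases hS : S ⊆ B
    · by_cases hB : i ∈ B
      · have hmem : i ∈ B \ S := Finset.mem_sdiff.2 ⟨hB, hi⟩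
        rw [if_pos hS, if_pos ⟨hB, hS⟩, pderiv_C_mul, pderiv_mul, hX0,
          ← Finset.mul_prod_erase _ _ hmem, pderiv_mul, pderiv_X_self,
          pderiv_prod_X_succ_of_notMem fun k hk hki =>
            Finset.ne_of_mem_erase hk (Fin.succ_injective _ hki),
          Finset.sdiff_insert]
        ring
      · rw [if_pos hS, if_neg fun h => hB h.1, pderiv_C_mul, pderiv_mul, hX0,
          hnot B fun h => hB (Finset.mem_sdiff.1 h).1]
        simp
    · rw [if_neg hS, if_neg fun h => hS h.2]

theorem pderiv_tutteDeriv_eq (a : ℕ) (S : Finset (Fin n)) (j : Fin (n + 1)) :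
    (∃ b U, pderiv j (tutteDeriv n q rk a S) = tutteDeriv n q rk b U) ∨
      pderiv j (tutteDeriv n q rk a S) = 0 := by
  refine Fin.cases (Or.inl ⟨_, _, pderiv_zero_tutteDeriv q rk a S⟩) (fun i => ?_) j
  rw [pderiv_succ_tutteDeriv]
  split_ifs
  · exact Or.inr rfl
  · exact Or.inl ⟨_, _, rfl⟩

theorem tutteDeriv_isHomogeneous {a d : ℕ} {S : Finset (Fin n)} (h : d + a + #S = n) :
    (tutteDeriv n q rk a S).IsHomogeneous d := by
  refine IsHomogeneous.sum _ _ _ fun B hB => ?_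
  have hSB := (Finset.mem_filter.1 hB).2
  have hcard := Finset.card_le_card hSB
  have hBn : #B ≤ n := by simpa using Finset.card_le_univ B
  by_cases ha : n - #B < a
  · rw [Nat.descFactorial_eq_zero_iff_lt.2 ha]
    simpa using isHomogeneous_zero _ _ d
  · have hd : d = 0 + ((∑ i ∈ B \ S, 1) + 1 * (n - #B - a)) := by
      rw [← Finset.card_eq_sum_ones, Finset.card_sdiff_of_subset hSB]
      omega
    rw [hd]
    exact (isHomogeneous_C _ _).mul ((IsHomogeneous.prod _ _ _ fun i _ => isHomogeneous_X _ _).mul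
      ((isHomogeneous_X _ _).pow _))

variable {q}

theorem eval_tutteDeriv_term_nonneg (hq : 0 < q) {w : Fin (n + 1) → ℝ} (hw : ∀ i, 0 < w i) (a : ℕ)
    (S B : Finset (Fin n)) : 0 ≤ eval w (C (q ^ (-(rk B : ℤ)) * (n - #B).descFactorial a) *
      ((∏ i ∈ B \ S, X i.succ) * X 0 ^ (n - #B - a))) := by
  simp only [map_mul, eval_C, map_prod, eval_X, map_pow]
  have := Finset.prod_nonneg fun i (_ : i ∈ B \ S) => (hw i.succ).le
  have := (hw 0).le
  positivity

theorem eval_tutteDeriv_nonneg (hq : 0 < q) {w : Fin (n + 1) → ℝ} (hw : ∀ i, 0 < w i) (a : ℕ)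
    (S : Finset (Fin n)) : 0 ≤ eval w (tutteDeriv n q rk a S) := by
  rw [tutteDeriv, map_sum]
  exact Finset.sum_nonneg fun B _ => eval_tutteDeriv_term_nonneg rk hq hw a S B

theorem eval_tutteDeriv_pos (hq : 0 < q) {w : Fin (n + 1) → ℝ} (hw : ∀ i, 0 < w i) {a : ℕ}
    {S : Finset (Fin n)} (h : a + #S ≤ n) : 0 < eval w (tutteDeriv n q rk a S) := by
  rw [tutteDeriv, map_sum]
  refine Finset.sum_pos' (fun B _ => eval_tutteDeriv_term_nonneg rk hq hw a S B) ⟨S, by simp, ?_⟩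
  have h0 := hw 0
  have h1 : (0 : ℝ) < (n - #S).descFactorial a := Nat.cast_pos.2 <|
    Nat.pos_of_ne_zero fun h' => by rw [Nat.descFactorial_eq_zero_iff_lt] at h'; omega
  simp only [map_mul, eval_C, eval_X, map_pow, Finset.sdiff_self, Finset.prod_empty, map_one]
  exact mul_pos (mul_pos (zpow_pos hq _) h1) (mul_pos one_pos (pow_pos h0 _))

theorem eval_tutteDeriv_of_degree_zero (w : Fin (n + 1) → ℝ) {a : ℕ} {S : Finset (Fin n)}
    (h : a + #S = n) : eval w (tutteDeriv n q rk a S) = q ^ (-(rk S : ℤ)) * a.factorial := by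
  rw [tutteDeriv, map_sum, Finset.sum_eq_single S]
  · rw [show n - #S = a by omega]
    simp [Nat.descFactorial_self]
  · intro B hB hne
    have hlt := Finset.card_lt_card ((Finset.mem_filter.1 hB).2.ssubset_of_ne hne.symm)
    have hBn : #B ≤ n := by simpa using Finset.card_le_univ B
    rw [Nat.descFactorial_eq_zero_iff_lt.2 (by omega)]
    simp
  · simp

end TutteDerivatives

section Lorentzian

open Matrix

/-- The quadratic form of a symmetric matrix with a positive corner entry, after eliminating the
corner variable. -/
theorem reverseCauchySchwarz_single_zero {n : ℕ} {H : Matrix (Fin (n + 1)) (Fin (n + 1)) ℝ}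
    (hH : H.IsSymm) (h : ∀ x : Fin n → ℝ,
      H 0 0 * ∑ i, ∑ j, H i.succ j.succ * (x i * x j) ≤ (∑ i, H 0 i.succ * x i) ^ 2) :
    ReverseCauchySchwarz H (Pi.single 0 1) := by
  intro x
  rw [single_one_dotProduct, single_one_dotProduct, mulVec_single_one]
  have hx := h fun i => x i.succ
  have h1 : (H *ᵥ x) 0 = H 0 0 * x 0 + ∑ i : Fin n, H 0 i.succ * x i.succ := Fin.sum_univ_succ _
  have h2 : x ⬝ᵥ H *ᵥ x = H 0 0 * x 0 ^ 2 + 2 * x 0 * (∑ i : Fin n, H 0 i.succ * x i.succ) +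
      ∑ i : Fin n, ∑ j : Fin n, H i.succ j.succ * (x i.succ * x j.succ) := by
    have h3 : ∀ i : Fin n, x i.succ * (H *ᵥ x) i.succ = x 0 * (H 0 i.succ * x i.succ) +
        ∑ j : Fin n, H i.succ j.succ * (x i.succ * x j.succ) := by
      intro i
      have h4 : (H *ᵥ x) i.succ = H i.succ 0 * x 0 + ∑ j : Fin n, H i.succ j.succ * x j.succ :=
        Fin.sum_univ_succ _
      rw [h4, ← hH.apply i.succ 0, mul_add, Finset.mul_sum]
      refine congrArg₂ (· + ·) (by ring) (Finset.sum_congr rfl fun j _ => by ring)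
    rw [dotProduct, Fin.sum_univ_succ, h1]
    simp only [h3, Finset.sum_add_distrib, ← Finset.mul_sum]
    ring
  rw [h1, h2]
  change H 0 0 * _ ≤ _
  nlinarith

variable {n : ℕ} {q : ℝ} {rk : Finset (Fin n) → ℕ}

theorem hessian_tutteDeriv_zero_zero {a : ℕ} {S : Finset (Fin n)} (h : 2 + a + #S = n)
    (w : Fin (n + 1) → ℝ) :
    hessian (tutteDeriv n q rk a S) w 0 0 = q ^ (-(rk S : ℤ)) * (a + 2).factorial := by
  rw [hessian_apply, pderiv_zero_tutteDeriv, pderiv_zero_tutteDeriv,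
    eval_tutteDeriv_of_degree_zero _ _ (by omega)]

theorem hessian_tutteDeriv_zero_succ (hq0 : 0 < q) {a : ℕ} {S : Finset (Fin n)}
    (h : 2 + a + #S = n) (w : Fin (n + 1) → ℝ) (i : Fin n) :
    hessian (tutteDeriv n q rk a S) w 0 i.succ = if i ∈ Sᶜ then
      q ^ (-(rk S : ℤ)) * (a + 1).factorial * q ^ ((rk S : ℤ) - rk (insert i S)) else 0 := by
  rw [hessian_apply, pderiv_succ_tutteDeriv]
  by_cases hi : i ∈ S
  · simp [hi]
  · rw [if_neg hi, if_pos (Finset.mem_compl.2 hi), pderiv_zero_tutteDeriv,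
      eval_tutteDeriv_of_degree_zero _ _ (by rw [Finset.card_insert_of_notMem hi]; omega),
      mul_right_comm, ← zpow_add₀ hq0.ne']
    congr 2
    ring

open Classical in
theorem hessian_tutteDeriv_succ_succ (hrk : IsMatroidRank n rk) (hq0 : 0 < q) {a : ℕ}
    {S : Finset (Fin n)} (h : 2 + a + #S = n) (w : Fin (n + 1) → ℝ) (i j : Fin n) :
    hessian (tutteDeriv n q rk a S) w i.succ j.succ = if i ∈ Sᶜ then (if j ∈ Sᶜ then
      q ^ (-(rk S : ℤ)) * a.factorial * (if i = j then 0 else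
        (if Quotient.mk (parallelSetoid hrk S) i = Quotient.mk (parallelSetoid hrk S) j
          then q else 1) *
        (q ^ ((rk S : ℤ) - rk (insert i S)) * q ^ ((rk S : ℤ) - rk (insert j S))))
      else 0) else 0 := by
  rw [hessian_apply, pderiv_succ_tutteDeriv]
  by_cases hj : j ∈ S
  · simp [hj]
  rw [if_neg hj, pderiv_succ_tutteDeriv]
  by_cases hi : i ∈ S
  · simp [hi]
  rw [if_pos (Finset.mem_compl.2 hi), if_pos (Finset.mem_compl.2 hj)]
  by_cases hne : i = j
  · simp [hne]
  have hmem : i ∉ insert j S := by simp [hne, hi]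
  rw [if_neg hmem, if_neg hne, eval_tutteDeriv_of_degree_zero _ _
    (by rw [Finset.card_insert_of_notMem hmem, Finset.card_insert_of_notMem hj]; omega),
    zpow_rank_insert_insert hrk hq0 S hne]
  ring

/-- A nonnegative matrix built from a partition of `T`, bordered by one extra row and column, as
in the quadratic derivatives of `ZM`. -/
theorem reverseCauchySchwarz_of_partition {κ : Type*} [DecidableEq κ]
    {H : Matrix (Fin (n + 1)) (Fin (n + 1)) ℝ} (hsymm : H.IsSymm) {T : Finset (Fin n)} {a : ℕ}
    (hT : #T = a + 2) (φ : Fin n → κ) {g : Fin n → ℝ} (hg : ∀ i, 0 ≤ g i) {p : ℝ} (hp : 0 < p)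
    (hq0 : 0 ≤ q) (hq1 : q ≤ 1) (h00 : H 0 0 = p * (a + 2).factorial)
    (h0i : ∀ i : Fin n, H 0 i.succ = if i ∈ T then p * (a + 1).factorial * g i else 0)
    (hij : ∀ i j : Fin n, H i.succ j.succ = if i ∈ T then (if j ∈ T then
      p * a.factorial * (if i = j then 0 else (if φ i = φ j then q else 1) * (g i * g j))
      else 0) else 0)
    {w : Fin (n + 1) → ℝ} (hw : ∀ i, 0 < w i) : ReverseCauchySchwarz H w := by
  have hbase : ReverseCauchySchwarz H (Pi.single 0 1) := by
    refine reverseCauchySchwarz_single_zero hsymm fun x => ?_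
    have hL : ∑ i, H 0 i.succ * x i = p * (a + 1).factorial * ∑ i ∈ T, g i * x i := by
      simp only [h0i, ite_mul, zero_mul]
      rw [Finset.sum_ite_mem, Finset.univ_inter, Finset.mul_sum]
      exact Finset.sum_congr rfl fun i _ => by ring
    have hK : ∑ i, ∑ j, H i.succ j.succ * (x i * x j) = p * a.factorial * ∑ i ∈ T, ∑ j ∈ T,
        (if i = j then 0 else (if φ i = φ j then q else 1) * ((g i * x i) * (g j * x j))) := by
      have hpush : ∀ i, ∑ j, H i.succ j.succ * (x i * x j) = if i ∈ T then
          p * a.factorial * ∑ j ∈ T, (if i = j then 0 else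
            (if φ i = φ j then q else 1) * ((g i * x i) * (g j * x j))) else 0 := by
        intro i
        by_cases hi : i ∈ T
        · simp only [hij, if_pos hi, ite_mul (_ ∈ T), zero_mul]
          rw [Finset.sum_ite_mem, Finset.univ_inter, Finset.mul_sum]
          refine Finset.sum_congr rfl fun j _ => ?_
          by_cases hne : i = j
          · simp [hne]
          · rw [if_neg hne, if_neg hne]; ring
        · simp only [hij, if_neg hi, zero_mul, Finset.sum_const_zero]
      simp only [hpush]
      rw [Finset.sum_ite_mem, Finset.univ_inter, Finset.mul_sum]
    have key := card_mul_sum_offDiag_le T φ (fun i => g i * x i) hq0 hq1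
    rw [hL, hK, h00, Nat.factorial_succ (a + 1)]
    rw [hT] at key
    generalize ∑ i ∈ T, g i * x i = Y at key ⊢
    generalize ∑ i ∈ T, ∑ j ∈ T, (if i = j then 0 else
      (if φ i = φ j then q else 1) * ((g i * x i) * (g j * x j))) = K at key ⊢
    rw [Nat.factorial_succ a]
    generalize a.factorial = b
    push_cast at key ⊢
    have hc : 0 ≤ p ^ 2 * (a + 1) * (b : ℝ) ^ 2 := by positivity
    have := mul_le_mul_of_nonneg_left key hc
    linarith
  have hpos : 0 < (Pi.single 0 1 : Fin (n + 1) → ℝ) ⬝ᵥ H *ᵥ Pi.single 0 1 := by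
    rw [single_one_dotProduct, mulVec_single_one, col_apply, h00]
    exact mul_pos hp (Nat.cast_pos.2 (Nat.factorial_pos _))
  refine reverseCauchySchwarz_of_base hsymm hbase hpos ?_
  have hnn0 : ∀ j, 0 ≤ H 0 j := by
    intro j
    refine Fin.cases ?_ (fun j => ?_) j
    · rw [h00]; exact mul_nonneg hp.le (Nat.cast_nonneg _)
    · rw [h0i]
      split_ifs
      · exact mul_nonneg (mul_nonneg hp.le (Nat.cast_nonneg _)) (hg j)
      · exact le_rfl
  have hnn : ∀ i j, 0 ≤ H i j := by
    intro i j
    refine Fin.cases (hnn0 j) (fun i => ?_) i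
    refine Fin.cases ?_ (fun j => ?_) j
    · rw [← hsymm.apply]; exact hnn0 _
    · have h1 := hg i
      have h2 := hg j
      rw [hij]
      generalize a.factorial = b
      positivity
  exact Finset.sum_nonneg fun i _ => mul_nonneg (hw i).le
    (show 0 ≤ ∑ j, H i j * w j from Finset.sum_nonneg fun j _ => mul_nonneg (hnn i j) (hw j).le)

theorem reverseCauchySchwarz_hessian_tutteDeriv_of_quadratic (hrk : IsMatroidRank n rk)
    (hq0 : 0 < q) (hq1 : q ≤ 1) {a : ℕ} {S : Finset (Fin n)} (h : 2 + a + #S = n)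
    {w : Fin (n + 1) → ℝ} (hw : ∀ i, 0 < w i) :
    ReverseCauchySchwarz (hessian (tutteDeriv n q rk a S) w) w := by
  classical
  have hcard : #Sᶜ = a + 2 := by
    rw [Finset.card_compl, Fintype.card_fin]; omega
  exact reverseCauchySchwarz_of_partition (hessian_isSymm _ _) hcard
    (Quotient.mk (parallelSetoid hrk S)) (fun i => (zpow_pos hq0 _).le) (zpow_pos hq0 _) hq0.le hq1
    (hessian_tutteDeriv_zero_zero h w) (hessian_tutteDeriv_zero_succ hq0 h w)
    (hessian_tutteDeriv_succ_succ hrk hq0 h w) hw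

/-- The derivatives of the homogeneous multivariate Tutte polynomial are Lorentzian. -/
theorem reverseCauchySchwarz_hessian_tutteDeriv (hrk : IsMatroidRank n rk) (hq0 : 0 < q)
    (hq1 : q ≤ 1) {w : Fin (n + 1) → ℝ} (hw : ∀ i, 0 < w i) (d a : ℕ) (S : Finset (Fin n))
    (h : d + 2 + a + #S = n) : ReverseCauchySchwarz (hessian (tutteDeriv n q rk a S) w) w := by
  induction d generalizing a S with
  | zero => exact reverseCauchySchwarz_hessian_tutteDeriv_of_quadratic hrk hq0 hq1 (by omega) hw
  | succ d ih =>
    refine reverseCauchySchwarz_hessian_of_pderiv (d := d)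
      (tutteDeriv_isHomogeneous q rk (by omega)) hw ?_ 0 ?_ ?_
    · intro i j
      rw [hessian_apply]
      obtain ⟨b, U, hU⟩ | hU := pderiv_tutteDeriv_eq q rk a S j
      · rw [hU]
        obtain ⟨c, V, hV⟩ | hV := pderiv_tutteDeriv_eq q rk b U i
        · rw [hV]
          exact eval_tutteDeriv_nonneg rk hq0 hw _ _
        · rw [hV, map_zero]
      · rw [hU, map_zero, map_zero]
    · intro i
      rw [hessian_apply]
      refine Fin.cases (Or.inr ?_) (fun i => ?_) i
      · rw [pderiv_zero_tutteDeriv, pderiv_zero_tutteDeriv]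
        exact eval_tutteDeriv_pos rk hq0 hw (by omega)
      · rw [pderiv_succ_tutteDeriv]
        split_ifs with hi
        · exact Or.inl rfl
        · rw [pderiv_zero_tutteDeriv]
          exact Or.inr (eval_tutteDeriv_pos rk hq0 hw
            (by rw [Finset.card_insert_of_notMem hi]; omega))
    · intro i
      refine Fin.cases ?_ (fun i => ?_) i
      · rw [pderiv_zero_tutteDeriv]
        exact ih _ _ (by omega)
      · rw [pderiv_succ_tutteDeriv]
        split_ifs with hi
        · have h0 : hessian (0 : MvPolynomial (Fin (n + 1)) ℝ) w = 0 := by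
            ext i j
            simp [hessian_apply]
          intro x
          simp [h0]
        · exact ih _ _ (by rw [Finset.card_insert_of_notMem hi]; omega)

end Lorentzian

theorem statement16 (n : ℕ) (hn : 2 ≤ n) (rk : Finset (Fin n) → ℕ)
    (hrk : IsMatroidRank n rk) (q : ℝ) (hq0 : 0 < q) (hq1 : q ≤ 1) :
    ConcaveOn ℝ {w : Fin (n+1) → ℝ | ∀ i, 0 < w i}
      (fun w => Real.log (eval w (ZM n q rk))) ∧
    ∀ u v : Fin (n+1) → ℝ, (∀ i, 0 < u i) → (∀ i, 0 < v i) →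
      ∀ t : ℝ, 0 ≤ t → t ≤ 1 →
        (eval u (ZM n q rk)) ^ t * (eval v (ZM n q rk)) ^ (1 - t) ≤
          eval (fun i => t * u i + (1 - t) * v i) (ZM n q rk) := by
  obtain ⟨d, rfl⟩ := Nat.exists_eq_add_of_le' hn
  have hpos : ∀ w : Fin (d + 2 + 1) → ℝ, (∀ i, 0 < w i) → 0 < eval w (ZM (d + 2) q rk) := by
    intro w hw
    rw [ZM_eq_tutteDeriv]
    exact eval_tutteDeriv_pos rk hq0 hw (by simp)
  have hconc : ConcaveOn ℝ {w : Fin (d + 2 + 1) → ℝ | ∀ i, 0 < w i}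
      (fun w => Real.log (eval w (ZM (d + 2) q rk))) := by
    refine concaveOn_log_eval_of_hessian (d := d) ?_ hpos fun w hw => ?_
    · rw [ZM_eq_tutteDeriv]
      exact tutteDeriv_isHomogeneous q rk (by simp)
    · rw [ZM_eq_tutteDeriv]
      exact reverseCauchySchwarz_hessian_tutteDeriv hrk hq0 hq1 hw d 0 ∅ (by simp)
  refine ⟨hconc, fun u v hu hv t ht0 ht1 => ?_⟩
  have hmem := hconc.1 hu hv ht0 (sub_nonneg.2 ht1) (by ring)
  have h := hconc.2 hu hv ht0 (sub_nonneg.2 ht1) (by ring)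
  rw [Real.rpow_def_of_pos (hpos u hu), Real.rpow_def_of_pos (hpos v hv), ← Real.exp_add,
    mul_comm _ t, mul_comm _ (1 - t)]
  exact (Real.le_log_iff_exp_le (hpos _ hmem)).1 h
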